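/- Let S ⊆ P(ℕ) be a nonempty chain. Then: (1) if inf{d_ν(⋃S, A) : A ∈ S} = 0, then ν⁺(⋃S) = sup{ν⁺(A) : A ∈ S}; (2) if inf{d_ν(A, ⋂S) : A ∈ S} = 0, then ν⁻(⋂S) = inf{ν⁻(A) : A ∈ S}. Moreover, if S ⊆ F and ⋃S ∈ F, the converse of (1) holds (with ν in place of ν⁺), and if S ⊆ F and ⋂S ∈ F, the converse of (2) holds. -/

import Mathlib

/-- The partial average `ν_N(A) = (1/N)·∑_{n=1}^N 1_A(n)`. -/
noncomputable def nuN (A : Set ℕ) (N : ℕ) : ℝ :=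
  (∑ n ∈ Finset.Icc 1 N, A.indicator (fun _ => (1 : ℝ)) n) / N

/-- The upper Cesàro limit `ν⁺(A)`. -/
noncomputable def nuPlus (A : Set ℕ) : ℝ :=
  Filter.limsup (fun N => nuN A N) Filter.atTop

/-- The lower Cesàro limit `ν⁻(A)`. -/
noncomputable def nuMinus (A : Set ℕ) : ℝ :=
  Filter.liminf (fun N => nuN A N) Filter.atTop

/-- `A ∈ F`: the Cesàro limit of `A` exists. -/
def memF (A : Set ℕ) : Prop :=
  ∃ l : ℝ, Filter.Tendsto (fun N => nuN A N) Filter.atTop (nhds l)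

/-- The Cesàro limit `ν(A)`; it coincides with `ν⁺(A)` whenever `A ∈ F`. -/
noncomputable def nu (A : Set ℕ) : ℝ := nuPlus A

/-- `A ∈ N`: `A` is a null set. -/
def nullSet (A : Set ℕ) : Prop := memF A ∧ nu A = 0

/-- The pseudo-metric `d_ν(B,C) = ν⁺(B △ C)`. -/
noncomputable def dnu (B C : Set ℕ) : ℝ := nuPlus (symmDiff B C)

namespace Cesaro

open Filter

lemma nuN_nonneg (A : Set ℕ) (N : ℕ) : 0 ≤ nuN A N :=
  div_nonneg (Finset.sum_nonneg fun _ _ => Set.indicator_nonneg (fun _ _ => zero_le_one) _)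
    N.cast_nonneg

lemma nuN_le_one (A : Set ℕ) (N : ℕ) : nuN A N ≤ 1 := by
  refine div_le_one_of_le₀ ?_ N.cast_nonneg
  calc ∑ n ∈ Finset.Icc 1 N, A.indicator (fun _ => (1 : ℝ)) n
      ≤ ∑ _n ∈ Finset.Icc 1 N, (1 : ℝ) :=
        Finset.sum_le_sum fun n _ => Set.indicator_le_self' (fun _ _ => zero_le_one) n
    _ = N := by simp

lemma nuN_mono {A B : Set ℕ} (h : A ⊆ B) (N : ℕ) : nuN A N ≤ nuN B N := by
  unfold nuN
  gcongr with n

lemma nuN_symmDiff_of_subset {A B : Set ℕ} (h : A ⊆ B) (N : ℕ) :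
    nuN (symmDiff B A) N = nuN B N - nuN A N := by
  rw [nuN, nuN, nuN, ← sub_div, ← Finset.sum_sub_distrib]
  congr 1
  refine Finset.sum_congr rfl fun n _ => ?_
  have hn := @h n
  by_cases hA : n ∈ A <;> by_cases hB : n ∈ B <;> simp_all [Set.mem_symmDiff]

lemma isBoundedUnder_le_nuN (A : Set ℕ) : IsBoundedUnder (· ≤ ·) atTop (nuN A) :=
  isBoundedUnder_of ⟨1, nuN_le_one A⟩

lemma isBoundedUnder_ge_nuN (A : Set ℕ) : IsBoundedUnder (· ≥ ·) atTop (nuN A) :=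
  isBoundedUnder_of ⟨0, nuN_nonneg A⟩

lemma nuPlus_nonneg (A : Set ℕ) : 0 ≤ nuPlus A :=
  le_limsup_of_frequently_le (Frequently.of_forall (nuN_nonneg A)) (isBoundedUnder_le_nuN A)

lemma nuPlus_le_one (A : Set ℕ) : nuPlus A ≤ 1 :=
  limsup_le_of_le (isBoundedUnder_ge_nuN A).isCoboundedUnder_le (.of_forall (nuN_le_one A))

lemma nuMinus_nonneg (A : Set ℕ) : 0 ≤ nuMinus A :=
  le_liminf_of_le (isBoundedUnder_le_nuN A).isCoboundedUnder_ge (.of_forall (nuN_nonneg A))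

lemma nuPlus_mono {A B : Set ℕ} (h : A ⊆ B) : nuPlus A ≤ nuPlus B :=
  limsup_le_limsup (.of_forall (nuN_mono h)) (isBoundedUnder_ge_nuN A).isCoboundedUnder_le
    (isBoundedUnder_le_nuN B)

lemma nuMinus_mono {A B : Set ℕ} (h : A ⊆ B) : nuMinus A ≤ nuMinus B :=
  liminf_le_liminf (.of_forall (nuN_mono h)) (isBoundedUnder_ge_nuN A)
    (isBoundedUnder_le_nuN B).isCoboundedUnder_ge

lemma eventually_nuN_lt {A : Set ℕ} {x : ℝ} (h : nuPlus A < x) : ∀ᶠ N in atTop, nuN A N < x :=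
  eventually_lt_of_limsup_lt h (isBoundedUnder_le_nuN A)

lemma nuPlus_le_add_dnu {A B : Set ℕ} (h : A ⊆ B) : nuPlus B ≤ nuPlus A + dnu B A := by
  refine le_of_forall_pos_le_add fun ε hε => ?_
  refine limsup_le_of_le (isBoundedUnder_ge_nuN B).isCoboundedUnder_le ?_
  filter_upwards [eventually_nuN_lt (lt_add_of_pos_right (nuPlus A) (half_pos hε)),
    eventually_nuN_lt (lt_add_of_pos_right (dnu B A) (half_pos hε))] with N h₁ h₂
  rw [nuN_symmDiff_of_subset h] at h₂
  linarith

lemma nuMinus_le_add_dnu {A B : Set ℕ} (h : A ⊆ B) : nuMinus B ≤ nuMinus A + dnu B A := by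
  refine le_of_forall_pos_le_add fun ε hε => ?_
  suffices nuMinus B - dnu B A - ε ≤ nuMinus A by linarith
  refine le_liminf_of_le (isBoundedUnder_le_nuN A).isCoboundedUnder_ge ?_
  filter_upwards [eventually_lt_of_lt_liminf (sub_lt_self (nuMinus B) (half_pos hε))
      (isBoundedUnder_ge_nuN B),
    eventually_nuN_lt (lt_add_of_pos_right (dnu B A) (half_pos hε))] with N h₁ h₂
  rw [nuN_symmDiff_of_subset h] at h₂
  linarith

lemma dnu_eq_nu_sub_nu {A B : Set ℕ} (h : A ⊆ B) (hA : memF A) (hB : memF B) :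
    dnu B A = nu B - nu A := by
  obtain ⟨a, ha⟩ := hA
  obtain ⟨b, hb⟩ := hB
  have hd : Tendsto (nuN (symmDiff B A)) atTop (nhds (b - a)) :=
    (hb.sub ha).congr fun N => (nuN_symmDiff_of_subset h N).symm
  rw [nu, nu, nuPlus, nuPlus, ha.limsup_eq, hb.limsup_eq]
  exact hd.limsup_eq

/-- An infimum of nonnegative reals vanishes as soon as it has arbitrarily small terms. -/
lemma sInf_image_eq_zero {α : Type*} {f : α → ℝ} {S : Set α} (h₀ : ∀ A ∈ S, 0 ≤ f A)
    (h : ∀ ε > 0, ∃ A ∈ S, f A < ε) : sInf (f '' S) = 0 := by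
  refine le_antisymm (le_of_forall_pos_le_add fun ε hε => ?_)
    (Real.sInf_nonneg (Set.forall_mem_image.2 h₀))
  obtain ⟨A, hA, hlt⟩ := h ε hε
  rw [zero_add]
  exact (csInf_le ⟨0, Set.forall_mem_image.2 h₀⟩ (Set.mem_image_of_mem f hA)).trans hlt.le

end Cesaro

open Cesaro

theorem stmt12 (S : Set (Set ℕ)) (hS : S.Nonempty) (hchain : IsChain (· ⊆ ·) S) :
    (sInf ((fun A => dnu (⋃₀ S) A) '' S) = 0 → nuPlus (⋃₀ S) = sSup (nuPlus '' S)) ∧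
    (sInf ((fun A => dnu A (⋂₀ S)) '' S) = 0 → nuMinus (⋂₀ S) = sInf (nuMinus '' S)) ∧
    ((∀ A ∈ S, memF A) → memF (⋃₀ S) →
      nu (⋃₀ S) = sSup (nu '' S) → sInf ((fun A => dnu (⋃₀ S) A) '' S) = 0) ∧
    ((∀ A ∈ S, memF A) → memF (⋂₀ S) →
      nu (⋂₀ S) = sInf (nu '' S) → sInf ((fun A => dnu A (⋂₀ S)) '' S) = 0) := by
  have hbdd : BddAbove (nuPlus '' S) := ⟨1, Set.forall_mem_image.2 fun A _ => nuPlus_le_one A⟩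
  have hbdd' : BddBelow (nuMinus '' S) := ⟨0, Set.forall_mem_image.2 fun A _ => nuMinus_nonneg A⟩
  refine ⟨fun h => le_antisymm ?_ ?_, fun h => le_antisymm ?_ ?_, fun hF hU h => ?_,
    fun hF hI h => ?_⟩
  · refine le_of_forall_pos_le_add fun ε hε => ?_
    obtain ⟨_, ⟨A, hA, rfl⟩, hlt⟩ := exists_lt_of_csInf_lt (hS.image _) (h.trans_lt hε)
    have h₁ := nuPlus_le_add_dnu (Set.subset_sUnion_of_mem hA)
    have h₂ := le_csSup hbdd (Set.mem_image_of_mem nuPlus hA)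
    dsimp only at hlt
    linarith
  · exact csSup_le (hS.image _)
      (Set.forall_mem_image.2 fun A hA => nuPlus_mono (Set.subset_sUnion_of_mem hA))
  · exact le_csInf (hS.image _)
      (Set.forall_mem_image.2 fun A hA => nuMinus_mono (Set.sInter_subset_of_mem hA))
  · refine le_of_forall_pos_le_add fun ε hε => ?_
    obtain ⟨_, ⟨A, hA, rfl⟩, hlt⟩ := exists_lt_of_csInf_lt (hS.image _) (h.trans_lt hε)
    have h₁ := nuMinus_le_add_dnu (Set.sInter_subset_of_mem hA)
    have h₂ := csInf_le hbdd' (Set.mem_image_of_mem nuMinus hA)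
    dsimp only at hlt
    linarith
  · refine sInf_image_eq_zero (fun A _ => nuPlus_nonneg _) fun ε hε => ?_
    obtain ⟨_, ⟨A, hA, rfl⟩, hlt⟩ := exists_lt_of_lt_csSup (hS.image nu)
      ((sub_lt_self _ hε).trans_eq h)
    refine ⟨A, hA, ?_⟩
    rw [dnu_eq_nu_sub_nu (Set.subset_sUnion_of_mem hA) (hF A hA) hU]
    linarith
  · refine sInf_image_eq_zero (fun A _ => nuPlus_nonneg _) fun ε hε => ?_
    obtain ⟨_, ⟨A, hA, rfl⟩, hlt⟩ := exists_lt_of_csInf_lt (hS.image nu)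
      (h.symm.trans_lt (lt_add_of_pos_right _ hε))
    refine ⟨A, hA, ?_⟩
    rw [dnu_eq_nu_sub_nu (Set.sInter_subset_of_mem hA) hI (hF A hA)]
    linarith
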